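/- arXiv:1207.0775 — 2 statements merged into one kernel-verified Lean document; each statement's English description precedes it below -/
import Mathlib

section
/- Let σ ∈ [0,1) and x ∈ ℝ^n. The vector v = 0 is a σ-approximate steepest descent direction at x if and only if x is a critical Pareto point of F. -/
open scoped Classical

noncomputable section

/-- `ℝ^n` as a Euclidean space. -/
abbrev E (n : ℕ) := EuclideanSpace ℝ (Fin n)

/-- The objective of the steepest-descent direction subproblem:
`v ↦ max_{1≤i≤m} ⟨∇f_i(x), v⟩ + (1/2)‖v‖²`. -/
def phi {n m : ℕ} (f : Fin m → E n → ℝ) (x v : E n) : ℝ :=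
  (⨆ i, (inner ℝ (gradient (f i) x) v : ℝ)) + (1 / 2) * ‖v‖ ^ 2

/-- `x` is a critical Pareto point: no direction `v` has `⟨∇f_i(x), v⟩ < 0` for all `i`. -/
def IsParetoCritical {n m : ℕ} (f : Fin m → E n → ℝ) (x : E n) : Prop :=
  ¬ ∃ v : E n, ∀ i, (inner ℝ (gradient (f i) x) v : ℝ) < 0

theorem phi_zero {n m : ℕ} (f : Fin m → E n → ℝ) (x : E n) : phi f x 0 = 0 := by
  simp [phi]

theorem inner_gradient_le_phi {n m : ℕ} (f : Fin m → E n → ℝ) (x v : E n) (i : Fin m) :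
    (inner ℝ (gradient (f i) x) v : ℝ) ≤ phi f x v := by
  have hle := le_ciSup (f := fun i => (inner ℝ (gradient (f i) x) v : ℝ))
    (Set.finite_range _).bddAbove i
  have hnn : 0 ≤ (1 / 2) * ‖v‖ ^ 2 := by positivity
  simp only [phi]
  linarith

theorem phi_smul {n m : ℕ} (f : Fin m → E n → ℝ) (x v : E n) {t : ℝ} (ht : 0 ≤ t) :
    phi f x (t • v) =
      t * (⨆ i, (inner ℝ (gradient (f i) x) v : ℝ)) + (1 / 2) * (t ^ 2 * ‖v‖ ^ 2) := by
  simp only [phi, inner_smul_right, norm_smul, mul_pow, Real.norm_eq_abs, sq_abs,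
    Real.mul_iSup_of_nonneg ht]

theorem exists_phi_neg {n m : ℕ} (hm : 0 < m) (f : Fin m → E n → ℝ) (x v : E n)
    (hv : ∀ i, (inner ℝ (gradient (f i) x) v : ℝ) < 0) : ∃ u : E n, phi f x u < 0 := by
  have : Nonempty (Fin m) := ⟨⟨0, hm⟩⟩
  obtain ⟨j, hj⟩ := exists_eq_ciSup_of_finite
    (f := fun i => (inner ℝ (gradient (f i) x) v : ℝ))
  have hneg := hj ▸ hv j
  set s := ⨆ i, (inner ℝ (gradient (f i) x) v : ℝ)
  have hden : 0 < ‖v‖ ^ 2 + 1 := by positivity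
  have ht : 0 < -s / (‖v‖ ^ 2 + 1) := div_pos (neg_pos.2 hneg) hden
  refine ⟨(-s / (‖v‖ ^ 2 + 1)) • v, ?_⟩
  rw [phi_smul f x v ht.le]
  change _ * s + _ < 0
  have hmul : -s / (‖v‖ ^ 2 + 1) * (‖v‖ ^ 2 + 1) = -s := div_mul_cancel₀ _ hden.ne'
  generalize -s / (‖v‖ ^ 2 + 1) = t at *
  have hs : s = -(t * (‖v‖ ^ 2 + 1)) := by linarith
  rw [hs]
  have h₁ : 0 < t ^ 2 := by positivity
  have h₂ : 0 ≤ t ^ 2 * ‖v‖ ^ 2 := by positivity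
  nlinarith

theorem stmt_5 {n m : ℕ} (hm : 0 < m) (f : Fin m → E n → ℝ)
    (hf : ∀ i, ContDiff ℝ 1 (f i)) (x : E n)
    (σ : ℝ) (hσ0 : 0 ≤ σ) (hσ1 : σ < 1)
    (vx : E n) (hmin : ∀ u : E n, phi f x vx ≤ phi f x u) :
    phi f x 0 ≤ (1 - σ) * phi f x vx ↔ IsParetoCritical f x := by
  rw [phi_zero, mul_nonneg_iff_of_pos_left (sub_pos.2 hσ1)]
  constructor
  · rintro h ⟨v, hv⟩
    obtain ⟨u, hu⟩ := exists_phi_neg hm f x v hv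
    exact absurd (h.trans (hmin u)) hu.not_ge
  · intro h
    simp only [IsParetoCritical, not_exists, not_forall, not_lt] at h
    obtain ⟨i, hi⟩ := h vx
    exact hi.trans (inner_gradient_le_phi f x vx i)
end
end

section
/- If {x^k} is an infinite sequence generated by the inexact steepest descent method with Armijo rule, then every accumulation point of {x^k} is a critical Pareto point of F. -/
open scoped Classical Topology

noncomputable section

/-- The optimal value `α(x)` of the steepest-descent direction subproblem. -/
def alphaVal {n m : ℕ} (f : Fin m → E n → ℝ) (x : E n) : ℝ :=
  ⨅ v : E n, phi f x v

/-- The set of candidate Armijo step sizes `2^{-j}` at `x` in direction `v`. -/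
def ArmijoSet {n m : ℕ} (f : Fin m → E n → ℝ) (β : ℝ) (x v : E n) : Set ℝ :=
  {s : ℝ | ∃ j : ℕ, s = (2 : ℝ) ^ (-(j : ℤ)) ∧
    ∀ i, f i (x + s • v) ≤ f i x + β * s * (inner ℝ (gradient (f i) x) v : ℝ)}

/-- The inexact steepest descent method with Armijo rule: at each iteration `k`,
`x k` is not a critical Pareto point, `v k` is a `σ`-approximate steepest descent
direction at `x k`, `t k` is the largest Armijo step size `2^{-j}`, and
`x (k+1) = x k + t k • v k`. -/
structure IsInexactSDMethod {n m : ℕ} (f : Fin m → E n → ℝ) (β σ : ℝ)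
    (x v : ℕ → E n) (t : ℕ → ℝ) : Prop where
  hβ0 : 0 < β
  hβ1 : β < 1
  hσ0 : 0 ≤ σ
  hσ1 : σ < 1
  not_crit : ∀ k, ¬ IsParetoCritical f (x k)
  approx : ∀ k, phi f (x k) (v k) ≤ (1 - σ) * alphaVal f (x k)
  step_mem : ∀ k, t k ∈ ArmijoSet f β (x k) (v k)
  step_max : ∀ k, ∀ s ∈ ArmijoSet f β (x k) (v k), s ≤ t k
  update : ∀ k, x (k + 1) = x k + t k • v k

lemma continuous_gradient_of_contDiff {n : ℕ} {g : E n → ℝ} (hg : ContDiff ℝ 1 g) :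
    Continuous (gradient g) :=
  (InnerProductSpace.toDual ℝ (E n)).symm.continuous.comp (hg.continuous_fderiv one_ne_zero)

lemma inner_gradient_add_le_phi {n m : ℕ} (f : Fin m → E n → ℝ) (x v : E n) (i : Fin m) :
    (inner ℝ (gradient (f i) x) v : ℝ) + (1 / 2) * ‖v‖ ^ 2 ≤ phi f x v := by
  unfold phi
  gcongr
  exact le_ciSup (f := fun i => (inner ℝ (gradient (f i) x) v : ℝ))
    (Set.finite_range _).bddAbove i

lemma phi_le {n m : ℕ} (hm : 0 < m) (f : Fin m → E n → ℝ) (x v : E n) {c : ℝ}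
    (h : ∀ i, (inner ℝ (gradient (f i) x) v : ℝ) ≤ c) :
    phi f x v ≤ c + (1 / 2) * ‖v‖ ^ 2 := by
  have : Nonempty (Fin m) := Fin.pos_iff_nonempty.mp hm
  unfold phi
  gcongr
  exact ciSup_le h

lemma alphaVal_le_phi {n m : ℕ} (hm : 0 < m) (f : Fin m → E n → ℝ) (x v : E n) :
    alphaVal f x ≤ phi f x v := by
  refine ciInf_le ⟨-(1 / 2) * ‖gradient (f ⟨0, hm⟩) x‖ ^ 2, ?_⟩ v
  rintro _ ⟨w, rfl⟩
  have h₁ := inner_gradient_add_le_phi f x w ⟨0, hm⟩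
  have h₂ := norm_add_sq_real (gradient (f ⟨0, hm⟩) x) w
  have h₃ := sq_nonneg ‖gradient (f ⟨0, hm⟩) x + w‖
  dsimp only
  linarith

lemma alphaVal_nonpos {n m : ℕ} (hm : 0 < m) (f : Fin m → E n → ℝ) (x : E n) :
    alphaVal f x ≤ 0 := by
  have h₁ := alphaVal_le_phi hm f x 0
  have h₂ := phi_le hm f x 0 (c := 0) (by simp)
  simp only [norm_zero] at h₂
  linarith

/-- Near a noncritical point the optimal value is bounded away from zero. -/
lemma exists_eventually_alphaVal_le {n m : ℕ} (hm : 0 < m) {f : Fin m → E n → ℝ}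
    (hf : ∀ i, ContDiff ℝ 1 (f i)) {p : E n} (hp : ¬ IsParetoCritical f p) :
    ∃ d > 0, ∀ᶠ x in 𝓝 p, alphaVal f x ≤ -d := by
  obtain ⟨w, hw⟩ := not_not.mp hp
  have : Nonempty (Fin m) := Fin.pos_iff_nonempty.mp hm
  obtain ⟨i₀, hi₀⟩ := Finite.exists_max fun i => (inner ℝ (gradient (f i) p) w : ℝ)
  obtain ⟨δ, hδ, hδw⟩ : ∃ δ > 0, ∀ i, (inner ℝ (gradient (f i) p) w : ℝ) < -δ := by
    refine ⟨-(inner ℝ (gradient (f i₀) p) w : ℝ) / 2, by linarith [hw i₀], fun i => ?_⟩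
    linarith [hw i₀, hi₀ i]
  have hev : ∀ᶠ x in 𝓝 p, ∀ i, (inner ℝ (gradient (f i) x) w : ℝ) < -δ := by
    refine Filter.eventually_all.mpr fun i => ?_
    have hc : Continuous fun x => (inner ℝ (gradient (f i) x) w : ℝ) :=
      (continuous_gradient_of_contDiff (hf i)).inner continuous_const
    exact hc.continuousAt.eventually_lt_const (hδw i)
  set s : ℝ := δ / (‖w‖ ^ 2 + 1)
  have hs : 0 < s := by positivity
  have hsw : s * (‖w‖ ^ 2 + 1) = δ := div_mul_cancel₀ _ (by positivity)
  refine ⟨s * δ / 2, by positivity, hev.mono fun x hx => ?_⟩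
  have h₁ := alphaVal_le_phi hm f x (s • w)
  have h₂ := phi_le hm f x (s • w) (c := -(s * δ)) fun i => by
    rw [real_inner_smul_right]
    nlinarith [hx i]
  rw [norm_smul, Real.norm_of_nonneg hs.le, mul_pow] at h₂
  nlinarith [sq_nonneg s]

/-- A single Armijo step size works for all points near `p` and all bounded directions of
uniform descent. -/
lemma exists_eventually_mem_ArmijoSet {n m : ℕ} {f : Fin m → E n → ℝ}
    (hf : ∀ i, ContDiff ℝ 1 (f i)) (p : E n) {β d R : ℝ} (hβ : β < 1) (hd : 0 < d)
    (hR : 0 ≤ R) :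
    ∃ s > 0, ∀ᶠ x in 𝓝 p, ∀ v : E n, ‖v‖ ≤ R →
      (∀ i, (inner ℝ (gradient (f i) x) v : ℝ) ≤ -d) → s ∈ ArmijoSet f β x v := by
  have hβ' : 0 < 1 - β := sub_pos.mpr hβ
  set ε : ℝ := (1 - β) * d / (2 * (R + 1))
  have hε : 0 < ε := by positivity
  have hεR : 2 * ε * R ≤ (1 - β) * d := by
    have : ε * (2 * (R + 1)) = (1 - β) * d := div_mul_cancel₀ _ (by positivity)
    linarith
  have hgrad : ∀ᶠ x in 𝓝 p, ∀ i, ‖gradient (f i) p - gradient (f i) x‖ < ε := by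
    refine Filter.eventually_all.mpr fun i => ?_
    have hc : Continuous fun x => ‖gradient (f i) p - gradient (f i) x‖ :=
      (continuous_const.sub (continuous_gradient_of_contDiff (hf i))).norm
    exact hc.continuousAt.eventually_lt_const (by simpa using hε)
  have hstrict : ∀ᶠ q : E n × E n in 𝓝 (p, p), ∀ i,
      ‖f i q.1 - f i q.2 - (inner ℝ (gradient (f i) p) (q.1 - q.2) : ℝ)‖
        ≤ ε * ‖q.1 - q.2‖ := by
    refine Filter.eventually_all.mpr fun i => ?_
    have h := ((hf i).contDiffAt (x := p)).hasStrictFDerivAt one_ne_zero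
    filter_upwards [h.isLittleO.def hε] with q hq
    simpa [gradient] using hq
  obtain ⟨r, hr, hball⟩ := Metric.eventually_nhds_iff.mp hstrict
  obtain ⟨j, hj⟩ := exists_pow_lt_of_lt_one (show 0 < r / (2 * (R + 1)) by positivity)
    (show (1 / 2 : ℝ) < 1 by norm_num)
  have hpow : (2 : ℝ) ^ (-(j : ℤ)) = (1 / 2) ^ j := by simp
  set s : ℝ := (2 : ℝ) ^ (-(j : ℤ))
  have hs : 0 < s := by positivity
  have hsR : s * R < r / 2 := by
    rw [← hpow, lt_div_iff₀ (by positivity)] at hj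
    linarith
  refine ⟨s, hs, ?_⟩
  filter_upwards [hgrad, Metric.ball_mem_nhds p (half_pos hr)] with x hx hxp v hv hdesc
  refine ⟨j, rfl, fun i => ?_⟩
  rw [Metric.mem_ball, dist_eq_norm] at hxp
  have hsv : ‖s • v‖ = s * ‖v‖ := by rw [norm_smul, Real.norm_of_nonneg hs.le]
  have hclose : dist (x + s • v, x) (p, p) < r := by
    rw [Prod.dist_eq, max_lt_iff, dist_eq_norm, dist_eq_norm]
    refine ⟨?_, by linarith⟩
    have h₁ : ‖x + s • v - p‖ ≤ ‖x - p‖ + ‖s • v‖ := by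
      rw [add_sub_right_comm]
      exact norm_add_le _ _
    have h₂ : s * ‖v‖ ≤ s * R := by gcongr
    linarith
  have hlin := (le_abs_self _).trans (hball hclose i)
  simp only [add_sub_cancel_left, real_inner_smul_right, hsv] at hlin
  have hdiff : (inner ℝ (gradient (f i) p) v : ℝ) - inner ℝ (gradient (f i) x) v ≤ ε * R := by
    rw [← inner_sub_left]
    refine (real_inner_le_norm _ _).trans ?_
    gcongr
    exact (hx i).le
  have hεv : ε * ‖v‖ ≤ ε * R := by gcongr
  have hkey : (inner ℝ (gradient (f i) p) v : ℝ) + ε * ‖v‖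
      ≤ β * inner ℝ (gradient (f i) x) v := by
    nlinarith [hdesc i]
  nlinarith [mul_le_mul_of_nonneg_left hkey hs.le]

namespace IsInexactSDMethod

variable {n m : ℕ} {f : Fin m → E n → ℝ} {β σ : ℝ} {x v : ℕ → E n} {t : ℕ → ℝ}

lemma step_pos (h : IsInexactSDMethod f β σ x v t) (k : ℕ) : 0 < t k := by
  obtain ⟨j, hj, -⟩ := h.step_mem k
  rw [hj]
  positivity

lemma apply_succ_le (h : IsInexactSDMethod f β σ x v t) (k : ℕ) (i : Fin m) :
    f i (x (k + 1)) ≤ f i (x k) + β * t k * (inner ℝ (gradient (f i) (x k)) (v k) : ℝ) := by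
  obtain ⟨-, -, hle⟩ := h.step_mem k
  rw [h.update]
  exact hle i

lemma inner_gradient_add_le (h : IsInexactSDMethod f β σ x v t) (k : ℕ) (i : Fin m) :
    (inner ℝ (gradient (f i) (x k)) (v k) : ℝ) + (1 / 2) * ‖v k‖ ^ 2
      ≤ (1 - σ) * alphaVal f (x k) :=
  (inner_gradient_add_le_phi f (x k) (v k) i).trans (h.approx k)

lemma antitone_apply (h : IsInexactSDMethod f β σ x v t) (hm : 0 < m) (i : Fin m) :
    Antitone fun k => f i (x k) := by
  refine antitone_nat_of_succ_le fun k => ?_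
  have h₁ := h.apply_succ_le k i
  have h₂ := h.inner_gradient_add_le k i
  have h₃ := mul_nonpos_of_nonneg_of_nonpos (sub_nonneg.mpr h.hσ1.le)
    (alphaVal_nonpos hm f (x k))
  have h₄ := mul_nonpos_of_nonneg_of_nonpos (mul_pos h.hβ0 (h.step_pos k)).le
    (show (inner ℝ (gradient (f i) (x k)) (v k) : ℝ) ≤ 0 by nlinarith [sq_nonneg ‖v k‖])
  linarith

lemma norm_direction_le (h : IsInexactSDMethod f β σ x v t) (hm : 0 < m) (k : ℕ)
    (i : Fin m) : ‖v k‖ ≤ 2 * ‖gradient (f i) (x k)‖ := by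
  have h₁ := h.inner_gradient_add_le k i
  have h₂ := mul_nonpos_of_nonneg_of_nonpos (sub_nonneg.mpr h.hσ1.le)
    (alphaVal_nonpos hm f (x k))
  have h₃ := neg_le_of_abs_le (abs_real_inner_le_norm (gradient (f i) (x k)) (v k))
  by_contra! hlt
  nlinarith [norm_nonneg (gradient (f i) (x k)), norm_nonneg (v k)]

end IsInexactSDMethod

theorem stmt_13 {n m : ℕ} (hm : 0 < m) (f : Fin m → E n → ℝ)
    (hf : ∀ i, ContDiff ℝ 1 (f i)) (β σ : ℝ)
    (x v : ℕ → E n) (t : ℕ → ℝ)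
    (hmethod : IsInexactSDMethod f β σ x v t) :
    ∀ p : E n, MapClusterPt p Filter.atTop x → IsParetoCritical f p := by
  intro p hp
  by_contra hcrit
  obtain ⟨c, hc, hα⟩ := exists_eventually_alphaVal_le hm hf hcrit
  have hσ : 0 < 1 - σ := sub_pos.mpr hmethod.hσ1
  set d : ℝ := (1 - σ) * c
  have hd : 0 < d := mul_pos hσ hc
  let i₀ : Fin m := ⟨0, hm⟩
  set R : ℝ := 2 * (‖gradient (f i₀) p‖ + 1)
  obtain ⟨s, hs, harmijo⟩ :=
    exists_eventually_mem_ArmijoSet hf p hmethod.hβ1 hd (show 0 ≤ R by positivity)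
  have hη : 0 < β * s * d := mul_pos (mul_pos hmethod.hβ0 hs) hd
  have hgrad : ∀ᶠ y in 𝓝 p, ‖gradient (f i₀) y‖ < ‖gradient (f i₀) p‖ + 1 :=
    (continuous_gradient_of_contDiff (hf i₀)).norm.continuousAt.eventually_lt_const
      (lt_add_one _)
  have hval : ∀ᶠ y in 𝓝 p, f i₀ y < f i₀ p + β * s * d :=
    (hf i₀).continuous.continuousAt.eventually_lt_const (lt_add_of_pos_right _ hη)
  obtain ⟨k, hαk, harmijok, hgradk, hvalk⟩ :=
    (hp.frequently (hα.and (harmijo.and (hgrad.and hval)))).exists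
  have hdesc : ∀ i, (inner ℝ (gradient (f i) (x k)) (v k) : ℝ) ≤ -d := fun i => by
    have h₁ := hmethod.inner_gradient_add_le k i
    have h₂ := mul_le_mul_of_nonneg_left hαk hσ.le
    nlinarith [sq_nonneg ‖v k‖]
  have hst : s ≤ t k := hmethod.step_max k s <| harmijok (v k)
    ((hmethod.norm_direction_le hm k i₀).trans (by linarith)) hdesc
  have hdrop : f i₀ (x (k + 1)) < f i₀ p := by
    have h₁ := hmethod.apply_succ_le k i₀
    have h₂ : β * t k * (inner ℝ (gradient (f i₀) (x k)) (v k) : ℝ) ≤ β * t k * -d :=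
      mul_le_mul_of_nonneg_left (hdesc i₀) (mul_pos hmethod.hβ0 (hmethod.step_pos k)).le
    have h₃ : β * s * d ≤ β * t k * d :=
      mul_le_mul_of_nonneg_right (mul_le_mul_of_nonneg_left hst hmethod.hβ0.le) hd.le
    linarith
  have habove : ∀ᶠ y in 𝓝 p, f i₀ (x (k + 1)) < f i₀ y :=
    (hf i₀).continuous.continuousAt.eventually_const_lt hdrop
  obtain ⟨l, hl, hkl⟩ :=
    ((hp.frequently habove).and_eventually (Filter.eventually_ge_atTop (k + 1))).exists
  exact (hmethod.antitone_apply hm i₀ hkl).not_gt hl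
end
end
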